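/- For every positive integer N, every integer n with 0 ≤ n ≤ N−1, every complex Λ with 0 < |Λ| < 1, and every θ ∈ ℝ, the generating function of the (unnormalized) N-state Schrödinger cat Φ = ∑_{m=0}^{N−1} e^{−2πimn/N} Coh(Λe^{2πim/N}) ∈ ℓ²(ℕ, ℂ) is ⟨exp(iθÊ)⟩_Φ = e^{inθ}(1 − |Λ|^{2N})/(1 − |Λ|^{2N} e^{iNθ}). -/

import Mathlib

/-- Orthogonality of the powers of a primitive root of unity. -/
theorem IsPrimitiveRoot.sum_range_mul_inv_pow {K : Type*} [Field K] {ζ : K} {N : ℕ}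
    (hζ : IsPrimitiveRoot ζ N) (hN : 0 < N) (n j : ℕ) :
    ∑ m ∈ Finset.range N, (ζ ^ j * (ζ ^ n)⁻¹) ^ m = if j ≡ n [MOD N] then (N : K) else 0 := by
  have hζn : ζ ^ n ≠ 0 := pow_ne_zero _ (hζ.ne_zero hN.ne')
  have hone : ζ ^ j * (ζ ^ n)⁻¹ = 1 ↔ j ≡ n [MOD N] := by
    rw [mul_inv_eq_one₀ hζn, hζ.eq_orderOf, (hζ.isOfFinOrder hN.ne').pow_eq_pow_iff_modEq]
  split_ifs with h
  · simp [hone.2 h]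
  · rw [geom_sum_eq (mt hone.1 h), mul_pow, inv_pow, pow_right_comm, pow_right_comm ζ n,
      hζ.pow_eq_one]
    simp

/-- The geometric series restricted to an arithmetic progression. -/
theorem hasSum_geometric_modEq {K : Type*} [NormedField K] {z : K} (hz : ‖z‖ < 1) {N n : ℕ}
    (hn : n < N) :
    HasSum (fun j : ℕ ↦ if j ≡ n [MOD N] then z ^ j else 0) (z ^ n * (1 - z ^ N)⁻¹) := by
  have hN : 0 < N := n.zero_le.trans_lt hn
  have hinj : Function.Injective fun k : ℕ ↦ n + N * k := fun a b h ↦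
    Nat.eq_of_mul_eq_mul_left hN (Nat.add_left_cancel h)
  rw [← hinj.hasSum_iff]
  · have hzN : ‖z ^ N‖ < 1 := by
      rw [norm_pow]
      exact pow_lt_one₀ (norm_nonneg z) hz hN.ne'
    refine ((hasSum_geometric_of_norm_lt_one hzN).mul_left (z ^ n)).congr_fun ?_
    intro k
    simp [Nat.ModEq, pow_add, pow_mul]
  · intro j hj
    refine if_neg fun h ↦ hj ⟨j / N, ?_⟩
    have hmod : j % N = n := Eq.trans h (Nat.mod_eq_of_lt hn)
    change n + N * (j / N) = j
    rw [← hmod, Nat.mod_add_div]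


/-- For every positive integer `N`, integer `n` with `0 ≤ n ≤ N−1`, complex `Λ`
with `0 < |Λ| < 1` and `θ ∈ ℝ`, the generating function of the (unnormalized) `N`-state
Schrödinger cat `Φ = ∑_{m=0}^{N−1} e^{−2πimn/N} Coh(Λe^{2πim/N})`, whose `Δ_j`-coefficient is
`c j = ∑_{m<N} e^{−2πimn/N} (Λe^{2πim/N})^j`, is
`⟨exp(iθÊ)⟩_Φ = (∑_j e^{ijθ}|c j|²)/(∑_j |c j|²) = e^{inθ}(1 − |Λ|^{2N})/(1 − |Λ|^{2N} e^{iNθ})`. -/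
theorem N_cat_generating_function (N : ℕ) (hN : 0 < N) (n : ℕ) (hn : n < N)
    (Λ : ℂ) (h0 : Λ ≠ 0) (h1 : ‖Λ‖ < 1) (θ : ℝ)
    (c : ℕ → ℂ)
    (hc : ∀ j : ℕ, c j = ∑ m ∈ Finset.range N,
      Complex.exp (-(2 * (Real.pi : ℂ) * Complex.I * (m : ℂ) * (n : ℂ) / (N : ℂ))) *
        (Λ * Complex.exp (2 * (Real.pi : ℂ) * Complex.I * (m : ℂ) / (N : ℂ))) ^ j) :
    (∑' j : ℕ, Complex.exp (Complex.I * (j : ℂ) * (θ : ℂ)) * ((‖c j‖ ^ 2 : ℝ) : ℂ)) /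
        (∑' j : ℕ, ((‖c j‖ ^ 2 : ℝ) : ℂ))
      = Complex.exp (Complex.I * (n : ℂ) * (θ : ℂ)) * (1 - (‖Λ‖ : ℂ) ^ (2 * N)) /
          (1 - (‖Λ‖ : ℂ) ^ (2 * N) * Complex.exp (Complex.I * (N : ℂ) * (θ : ℂ))) := by
  have hNC : (N : ℂ) ≠ 0 := Nat.cast_ne_zero.2 hN.ne'
  have hζ := Complex.isPrimitiveRoot_exp N hN.ne'
  set ζ := Complex.exp (2 * Real.pi * Complex.I / N) with hζ_def
  have hcoeff (j : ℕ) : c j = if j ≡ n [MOD N] then (N : ℂ) * Λ ^ j else 0 := by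
    have hterm (m : ℕ) :
        Complex.exp (-(2 * (Real.pi : ℂ) * Complex.I * (m : ℂ) * (n : ℂ) / (N : ℂ))) *
          (Λ * Complex.exp (2 * (Real.pi : ℂ) * Complex.I * (m : ℂ) / (N : ℂ))) ^ j =
        Λ ^ j * (ζ ^ j * (ζ ^ n)⁻¹) ^ m := by
      rw [hζ_def, mul_pow, mul_left_comm, ← Complex.exp_nat_mul, ← Complex.exp_nat_mul,
        ← Complex.exp_nat_mul, ← Complex.exp_neg, ← Complex.exp_add, ← Complex.exp_add,
        ← Complex.exp_nat_mul]
      congr 2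
      ring
    simp_rw [hc, hterm]
    rw [← Finset.mul_sum, hζ.sum_range_mul_inv_pow hN]
    split_ifs <;> ring
  have hsum (φ : ℝ) :
      HasSum (fun j : ℕ ↦ Complex.exp (Complex.I * j * φ) * ((‖c j‖ ^ 2 : ℝ) : ℂ))
        ((N : ℂ) ^ 2 * (Complex.exp (Complex.I * n * φ) * (‖Λ‖ : ℂ) ^ (2 * n) *
          (1 - (‖Λ‖ : ℂ) ^ (2 * N) * Complex.exp (Complex.I * N * φ))⁻¹)) := by
    set z : ℂ := (‖Λ‖ : ℂ) ^ 2 * Complex.exp (Complex.I * φ) with hz_def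
    have hz : ‖z‖ < 1 := by
      rw [hz_def, norm_mul, mul_comm Complex.I, Complex.norm_exp_ofReal_mul_I, mul_one, norm_pow,
        Complex.norm_real, norm_norm]
      exact pow_lt_one₀ (norm_nonneg Λ) h1 two_ne_zero
    have hzpow (k : ℕ) : z ^ k = (‖Λ‖ : ℂ) ^ (2 * k) * Complex.exp (Complex.I * k * φ) := by
      rw [hz_def, mul_pow, ← pow_mul, ← Complex.exp_nat_mul]
      ring_nf
    have h := (hasSum_geometric_modEq hz hn).mul_left ((N : ℂ) ^ 2)
    rw [hzpow n, hzpow N, mul_comm ((‖Λ‖ : ℂ) ^ (2 * n))] at h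
    refine h.congr_fun fun j ↦ ?_
    rw [hcoeff]
    split_ifs
    · rw [hzpow, norm_mul, norm_pow, Complex.norm_natCast]
      push_cast
      ring
    · simp
  have hden := hsum 0
  simp only [Complex.ofReal_zero, mul_zero, Complex.exp_zero, one_mul, mul_one] at hden
  rw [(hsum θ).tsum_eq, hden.tsum_eq]
  have hΛ : (‖Λ‖ : ℂ) ≠ 0 := Complex.ofReal_ne_zero.2 (norm_ne_zero_iff.2 h0)
  have hone : 1 - (‖Λ‖ : ℂ) ^ (2 * N) ≠ 0 := by
    have hlt : ‖Λ‖ ^ (2 * N) < 1 := pow_lt_one₀ (norm_nonneg Λ) h1 (by positivity)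
    exact_mod_cast (sub_pos.2 hlt).ne'
  rw [div_eq_mul_inv _ (1 - _ * _)]
  field_simp
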